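/- arXiv:1511.07424 — 3 statements merged into one kernel-verified Lean document; each statement's English description precedes it below -/
import Mathlib

section
/- For every natural number n, in the ring of Gaussian integers ℤ[i] the following identity holds: (P(2n+2) + 1)^5 + (P(2n+2) − 1)^5 = (P(2n+2) + i·(P(2n+2) + P(2n+1)))^5 + (P(2n+2) − i·(P(2n+2) + P(2n+1)))^5, where P denotes the Pell number sequence. In particular, each even-indexed Pell number yields a solution of w^5 + x^5 = y^5 + z^5 in which w and x are (rational) integers and y and z are a conjugate pair of Gaussian integers. -/
local notation "ℤ[i]" => GaussianInt

/-- The Pell numbers: P 0 = 0, P 1 = 1, P (n+2) = 2 * P (n+1) + P n. -/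
def pell : ℕ → ℤ
  | 0 => 0
  | 1 => 1
  | n + 2 => 2 * pell (n + 1) + pell n

/-- Consecutive Pell numbers satisfy a norm equation for `x ^ 2 + 2 * x * y - y ^ 2`. -/
theorem pell_odd_even_norm (n : ℕ) :
    pell (2 * n + 1) ^ 2 + 2 * pell (2 * n + 1) * pell (2 * n + 2) - pell (2 * n + 2) ^ 2 = 1 := by
  induction n with
  | zero => decide
  | succ k ih =>
    have h₁ : pell (2 * (k + 1) + 1) = 2 * pell (2 * k + 2) + pell (2 * k + 1) := by
      rw [show 2 * (k + 1) + 1 = 2 * k + 1 + 2 by ring, pell]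
    have h₂ : pell (2 * (k + 1) + 2) = 2 * pell (2 * (k + 1) + 1) + pell (2 * k + 2) := by
      rw [pell, show 2 * (k + 1) = 2 * k + 2 by ring]
    rw [h₂, h₁]
    linear_combination ih

/-- The quintic identity behind the Pell solutions of `w ^ 5 + x ^ 5 = y ^ 5 + z ^ 5`. -/
theorem fifth_power_add_eq_of_norm {R : Type*} [CommRing R] {a b i : R} (hi : i ^ 2 = -1)
    (h : b ^ 2 + 2 * b * a - a ^ 2 = 1) :
    (a + 1) ^ 5 + (a - 1) ^ 5 = (a + i * (a + b)) ^ 5 + (a - i * (a + b)) ^ 5 := by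
  have hs : (a + b) ^ 2 = 2 * a ^ 2 + 1 := by linear_combination h
  linear_combination (-20 * a ^ 3 * (a + b) ^ 2 - 10 * a * (a + b) ^ 4 * (i ^ 2 - 1)) * hi -
    10 * a * ((a + b) ^ 2 + 1) * hs

theorem pell_gaussian_fifth_power (n : ℕ) :
    ((pell (2 * n + 2) : ℤ[i]) + 1) ^ 5 + ((pell (2 * n + 2) : ℤ[i]) - 1) ^ 5 =
      ((pell (2 * n + 2) : ℤ[i]) +
          Zsqrtd.sqrtd * ((pell (2 * n + 2) : ℤ[i]) + (pell (2 * n + 1) : ℤ[i]))) ^ 5 +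
        ((pell (2 * n + 2) : ℤ[i]) -
          Zsqrtd.sqrtd * ((pell (2 * n + 2) : ℤ[i]) + (pell (2 * n + 1) : ℤ[i]))) ^ 5 := by
  exact fifth_power_add_eq_of_norm (by decide)
    (by exact_mod_cast congrArg (Int.cast : ℤ → ℤ[i]) (pell_odd_even_norm n))
end

section
/- If a, b, c are integers forming a Pythagorean triple, i.e., a^2 + b^2 = c^2, then in the ring of Gaussian integers ℤ[i] one has (a + b + c·i)^5 + (a − b − c·i)^5 = (a − b + c·i)^5 + (a + b − c·i)^5. Hence every Pythagorean triple yields a Gaussian integer solution of A^5 + B^5 = C^5 + D^5. -/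
local notation "ℤ[i]" => GaussianInt

theorem pow_five_add_pow_five_sub_eq {R : Type*} [CommRing R] (x y z : R) :
    (x + y + z) ^ 5 + (x - y - z) ^ 5 - ((x - y + z) ^ 5 + (x + y - z) ^ 5) =
      80 * x * y * z * (x ^ 2 + y ^ 2 + z ^ 2) := by
  ring

theorem pow_five_add_pow_five_eq_of_sq_add_sq_add_sq_eq_zero {R : Type*} [CommRing R] {x y z : R}
    (h : x ^ 2 + y ^ 2 + z ^ 2 = 0) :
    (x + y + z) ^ 5 + (x - y - z) ^ 5 = (x - y + z) ^ 5 + (x + y - z) ^ 5 := by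
  rw [← sub_eq_zero, pow_five_add_pow_five_sub_eq, h, mul_zero]

theorem pythagorean_triple_gaussian_fifth_power (a b c : ℤ) (h : a ^ 2 + b ^ 2 = c ^ 2) :
    ((a : ℤ[i]) + (b : ℤ[i]) + (c : ℤ[i]) * Zsqrtd.sqrtd) ^ 5 +
        ((a : ℤ[i]) - (b : ℤ[i]) - (c : ℤ[i]) * Zsqrtd.sqrtd) ^ 5 =
      ((a : ℤ[i]) - (b : ℤ[i]) + (c : ℤ[i]) * Zsqrtd.sqrtd) ^ 5 +
        ((a : ℤ[i]) + (b : ℤ[i]) - (c : ℤ[i]) * Zsqrtd.sqrtd) ^ 5 := by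
  apply pow_five_add_pow_five_eq_of_sq_add_sq_add_sq_eq_zero
  have hi : (Zsqrtd.sqrtd : ℤ[i]) * Zsqrtd.sqrtd = -1 := by
    simp
  have hc : (a : ℤ[i]) ^ 2 + (b : ℤ[i]) ^ 2 = (c : ℤ[i]) ^ 2 := by
    exact_mod_cast h
  linear_combination hc + (c : ℤ[i]) ^ 2 * hi
end

section
/- The set of pairs (w, x) of positive integers for which there exists a Gaussian integer z with w^5 + x^5 = z^5 + (conjugate of z)^5 is infinite. Concretely, for every natural number n the pair (P(2n+2) + 1, P(2n+2) − 1) belongs to this set (witnessed by z = P(2n+2) + i·(P(2n+2) + P(2n+1))), and these pairs are pairwise distinct. -/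
local notation "ℤ[i]" => GaussianInt

theorem pell_add_two (n : ℕ) : pell (n + 2) = 2 * pell (n + 1) + pell n := rfl

theorem pell_succ_pos (n : ℕ) : 0 < pell (n + 1) ∧ 0 ≤ pell n := by
  induction n with
  | zero => decide
  | succ k ih => rw [pell_add_two]; omega

theorem two_le_pell_add_two (n : ℕ) : 2 ≤ pell (n + 2) := by
  have := pell_succ_pos n
  rw [pell_add_two]; omega

theorem pell_strictMono : StrictMono fun n : ℕ => pell (2 * n + 2) := by
  refine strictMono_nat_of_lt_succ fun n => ?_
  have h₁ := pell_succ_pos (2 * n + 1)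
  have h₂ := pell_succ_pos (2 * n + 2)
  have h₃ := pell_add_two (2 * n + 2)
  change pell (2 * n + 2) < pell (2 * n + 2 + 2)
  omega

/-- Consecutive Pell numbers solve the Pell equation `q ^ 2 - 2 * p ^ 2 = 1`. -/
theorem pell_add_sq_eq (n : ℕ) :
    (pell (2 * n + 2) + pell (2 * n + 1)) ^ 2 = 2 * pell (2 * n + 2) ^ 2 + 1 := by
  induction n with
  | zero => decide
  | succ k ih =>
    have h₁ : pell (2 * (k + 1) + 2) = 2 * pell (2 * (k + 1) + 1) + pell (2 * k + 2) :=
      pell_add_two _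
    have h₂ : pell (2 * (k + 1) + 1) = 2 * pell (2 * k + 2) + pell (2 * k + 1) :=
      pell_add_two _
    rw [h₁, h₂]
    linear_combination ih

/-- If `q ^ 2 = 2 * p ^ 2 + 1`, then `(p + 1) ^ 5 + (p - 1) ^ 5` is the sum of the fifth powers
of `p + q * i` and its conjugate. -/
theorem gaussian_fifth_power_identity {p q : ℤ} (h : q ^ 2 = 2 * p ^ 2 + 1) :
    ((p + 1 : ℤ) : ℤ[i]) ^ 5 + ((p - 1 : ℤ) : ℤ[i]) ^ 5 =
      ((p : ℤ[i]) + Zsqrtd.sqrtd * (q : ℤ[i])) ^ 5 +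
        (star ((p : ℤ[i]) + Zsqrtd.sqrtd * (q : ℤ[i]))) ^ 5 := by
  have hs : star ((p : ℤ[i]) + Zsqrtd.sqrtd * (q : ℤ[i])) = p - Zsqrtd.sqrtd * q := by
    ext <;> simp
  have hi : (Zsqrtd.sqrtd : ℤ[i]) ^ 2 = -1 := by
    rw [sq, Zsqrtd.dmuld]; simp
  have hi4 : (Zsqrtd.sqrtd : ℤ[i]) ^ 4 = 1 := by
    linear_combination ((Zsqrtd.sqrtd : ℤ[i]) ^ 2 - 1) * hi
  have hq : (q : ℤ[i]) ^ 2 = 2 * (p : ℤ[i]) ^ 2 + 1 := by exact_mod_cast h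
  rw [hs]
  push_cast
  linear_combination -20 * (p : ℤ[i]) ^ 3 * (q : ℤ[i]) ^ 2 * hi
    - 10 * (p : ℤ[i]) * (q : ℤ[i]) ^ 4 * hi4
    - 10 * (p : ℤ[i]) * ((q : ℤ[i]) ^ 2 + 1) * hq

theorem infinitely_many_integer_pairs_with_gaussian_conjugate_solution :
    {p : ℤ × ℤ | 0 < p.1 ∧ 0 < p.2 ∧
        ∃ z : ℤ[i], (p.1 : ℤ[i]) ^ 5 + (p.2 : ℤ[i]) ^ 5 = z ^ 5 + (star z) ^ 5}.Infinite ∧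
    (∀ n : ℕ,
      (0 < pell (2 * n + 2) + 1 ∧ 0 < pell (2 * n + 2) - 1 ∧
        ((pell (2 * n + 2) + 1 : ℤ) : ℤ[i]) ^ 5 + ((pell (2 * n + 2) - 1 : ℤ) : ℤ[i]) ^ 5 =
          ((pell (2 * n + 2) : ℤ[i]) +
              Zsqrtd.sqrtd * ((pell (2 * n + 2) : ℤ[i]) + (pell (2 * n + 1) : ℤ[i]))) ^ 5 +
            (star ((pell (2 * n + 2) : ℤ[i]) +
              Zsqrtd.sqrtd * ((pell (2 * n + 2) : ℤ[i]) + (pell (2 * n + 1) : ℤ[i])))) ^ 5)) ∧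
    Function.Injective (fun n : ℕ => ((pell (2 * n + 2) + 1, pell (2 * n + 2) - 1) : ℤ × ℤ)) := by
  have key (n : ℕ) := gaussian_fifth_power_identity (pell_add_sq_eq n)
  simp only [Int.cast_add (pell _) (pell _)] at key
  have pos (n : ℕ) : 0 < pell (2 * n + 2) + 1 ∧ 0 < pell (2 * n + 2) - 1 := by
    have := two_le_pell_add_two (2 * n)
    omega
  have inj : Function.Injective
      (fun n : ℕ => ((pell (2 * n + 2) + 1, pell (2 * n + 2) - 1) : ℤ × ℤ)) := by
    intro m n h
    exact pell_strictMono.injective (add_right_cancel (congrArg Prod.fst h))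
  refine ⟨Set.infinite_of_injective_forall_mem inj fun n => ?_,
    fun n => ⟨(pos n).1, (pos n).2, key n⟩, inj⟩
  exact ⟨(pos n).1, (pos n).2, _, key n⟩
end
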